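/- Every minimal vanishing sorou of weight 6 is a rotation of the multiset {ν_5, ν_5^2, ν_5^3, ν_5^4, −ν_3, −ν_3^2}; conversely, this multiset is a minimal vanishing sorou. -/

import Mathlib

open Complex

noncomputable def nu (n : ℕ) : ℂ := Complex.exp (2 * Real.pi * Complex.I / n)

def IsRootOfUnity (z : ℂ) : Prop := ∃ n : ℕ, 0 < n ∧ z ^ n = 1

def IsSorou (h : Multiset ℂ) : Prop := h ≠ 0 ∧ ∀ z ∈ h, IsRootOfUnity z

noncomputable def rootOrder (z : ℂ) : ℕ := sInf {d : ℕ | 0 < d ∧ z ^ d = 1}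

noncomputable def sorouOrder (h : Multiset ℂ) : ℕ := (h.map rootOrder).lcm

noncomputable def relOrder (h : Multiset ℂ) : ℕ :=
  (h.bind fun a => h.map fun b => rootOrder (a / b)).lcm

def IsMinVanishing (h : Multiset ℂ) : Prop :=
  h.sum = 0 ∧ ∀ g : Multiset ℂ, g ≤ h → g ≠ 0 → g ≠ h → g.sum ≠ 0

noncomputable def stmt13Sorou : Multiset ℂ :=
  ({nu 5, nu 5 ^ 2, nu 5 ^ 3, nu 5 ^ 4, -nu 3, -(nu 3 ^ 2)} : Multiset ℂ)

/-- If a multiset of `N`-th roots of unity sums to zero, so does the multiset of its `j`-th powers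
for every `j` coprime to `N`. -/
theorem sum_pow_eq_zero_of_coprime {N j : ℕ} (hN : 0 < N) (hj : j.Coprime N) {h : Multiset ℂ}
    (hh : ∀ z ∈ h, z ^ N = 1) (h0 : h.sum = 0) : (h.map fun z => z ^ j).sum = 0 := by
  have : NeZero N := ⟨hN.ne'⟩
  obtain ⟨ζ, hζ⟩ : ∃ ζ : ℂ, IsPrimitiveRoot ζ N := ⟨_, Complex.isPrimitiveRoot_exp N hN.ne'⟩
  have he : ∀ z : ℂ, ∃ i : ℕ, z ^ N = 1 → ζ ^ i = z := fun z => by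
    by_cases hz : z ^ N = 1
    · obtain ⟨i, -, hi⟩ := hζ.eq_pow_of_pow_eq_one hz
      exact ⟨i, fun _ => hi⟩
    · exact ⟨0, fun h => absurd h hz⟩
  choose e he using he
  let P : Polynomial ℤ := (h.map fun z => (Polynomial.X : Polynomial ℤ) ^ e z).sum
  have hP : ∀ x : ℂ, Polynomial.aeval x P = (h.map fun z => x ^ e z).sum := fun x => by
    simp [P, map_multiset_sum, Multiset.map_map]
  have hPζ : Polynomial.aeval ζ P = 0 := by
    rw [hP, Multiset.map_congr rfl fun z hz => he z (hh z hz), Multiset.map_id', h0]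
  have hdvd := minpoly.isIntegrallyClosed_dvd (hζ.isIntegral hN) hPζ
  rw [hζ.minpoly_eq_pow_coprime hj] at hdvd
  have := Polynomial.aeval_eq_zero_of_dvd_aeval_eq_zero hdvd (minpoly.aeval ℤ (ζ ^ j))
  rw [hP] at this
  rw [← this]
  refine congrArg _ (Multiset.map_congr rfl fun z hz => ?_)
  rw [← pow_mul, mul_comm, pow_mul, he z (hh z hz)]

theorem sum_range_pow_of_pow_eq_one {p : ℕ} {u : ℂ} (hu : u ^ p = 1) :
    ∑ k ∈ Finset.range p, u ^ k = if u = 1 then (p : ℂ) else 0 := by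
  split_ifs with h1
  · simp [h1]
  · rw [geom_sum_eq h1, hu, sub_self, zero_div]

/-- Fourier inversion for the partial sums of `h` over the fibres of `z ↦ z ^ M`. -/
theorem mul_sum_filter_pow_eq {p M : ℕ} {h : Multiset ℂ}
    (hh : ∀ z ∈ h, z ^ (p * M) = 1) {w : ℂ} (hw : w ^ p = 1) (hw0 : w ≠ 0) :
    (p : ℂ) * (h.filter fun z => z ^ M = w).sum =
      ∑ k ∈ Finset.range p, w⁻¹ ^ k * (h.map fun z => z ^ (1 + k * M)).sum := by
  have key : ∀ g : Multiset ℂ, (∀ z ∈ g, z ^ (p * M) = 1) →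
      (p : ℂ) * (g.filter fun z => z ^ M = w).sum =
      ∑ k ∈ Finset.range p, w⁻¹ ^ k * (g.map fun z => z ^ (1 + k * M)).sum := by
    intro g
    induction g using Multiset.induction_on with
    | empty => simp
    | cons a s ih =>
      intro hg
      have ha : (a ^ M / w) ^ p = 1 := by
        rw [div_pow, hw, div_one, ← pow_mul, mul_comm, hg a (Multiset.mem_cons_self a s)]
      have hs := ih fun z hz => hg z (Multiset.mem_cons_of_mem hz)
      have h1 : ∑ k ∈ Finset.range p, w⁻¹ ^ k * a ^ (1 + k * M) =
          a * if a ^ M / w = 1 then (p : ℂ) else 0 := by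
        rw [← sum_range_pow_of_pow_eq_one ha, Finset.mul_sum]
        refine Finset.sum_congr rfl fun k _ => ?_
        rw [pow_add, pow_one, mul_comm k, pow_mul, div_eq_mul_inv, mul_pow]
        ring
      simp only [Multiset.map_cons, Multiset.sum_cons, mul_add, Finset.sum_add_distrib]
      rw [← hs, h1, Multiset.filter_cons, Multiset.sum_add, mul_add]
      congr 1
      by_cases hc : a ^ M = w
      · simp [hc, hw0, mul_comm]
      · simp [hc, div_eq_one_iff_eq hw0]
  exact key h hh

theorem sum_filter_pow_eq_zero {p M : ℕ} (hp : p.Prime) (hM : 0 < M) (hpM : p ∣ M)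
    {h : Multiset ℂ} (hh : ∀ z ∈ h, z ^ (p * M) = 1) (h0 : h.sum = 0) {w : ℂ} (hw : w ^ p = 1) :
    (h.filter fun z => z ^ M = w).sum = 0 := by
  have hw0 : w ≠ 0 := by rintro rfl; simp [hp.ne_zero] at hw
  have := mul_sum_filter_pow_eq hh hw hw0
  rw [Finset.sum_eq_zero] at this
  · simpa [hp.ne_zero] using this
  · intro k _
    rw [sum_pow_eq_zero_of_coprime (mul_pos hp.pos hM) _ hh h0, mul_zero]
    have h1 : (1 + k * M).Coprime M := by simp
    exact Nat.Coprime.mul_right (h1.coprime_dvd_right hpM) h1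

theorem exists_sum_filter_pow_eq {p M : ℕ} (hp : p.Prime) (hM : 0 < M) (hpM : ¬ p ∣ M)
    {h : Multiset ℂ} (hh : ∀ z ∈ h, z ^ (p * M) = 1) (h0 : h.sum = 0) :
    ∃ B : ℂ, ∀ v : ℂ, v ^ p = 1 → (h.filter fun z => z ^ M = v ^ M).sum = v * B := by
  have : Fact p.Prime := ⟨hp⟩
  have hM0 : (M : ZMod p) ≠ 0 := by rwa [Ne, ZMod.natCast_eq_zero_iff]
  have hiff : ∀ k : ℕ, p ∣ 1 + k * M ↔ (k : ZMod p) = -(M : ZMod p)⁻¹ := fun k => by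
    rw [← ZMod.natCast_eq_zero_iff]
    push_cast
    constructor
    · intro hk
      field_simp
      linear_combination hk
    · intro hk
      rw [hk]
      field_simp
      simp
  set k₀ := (-(M : ZMod p)⁻¹).val with hk₀
  have hk₀p : k₀ < p := ZMod.val_lt _
  have hdvd : p ∣ 1 + k₀ * M := (hiff k₀).2 (by simp [hk₀])
  refine ⟨(h.map fun z => z ^ (1 + k₀ * M)).sum / p, fun v hv => ?_⟩
  have hv0 : v ≠ 0 := by rintro rfl; simp [hp.ne_zero] at hv
  have hmain := mul_sum_filter_pow_eq hh (w := v ^ M)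
    (by rw [← pow_mul, mul_comm, pow_mul, hv, one_pow]) (pow_ne_zero _ hv0)
  rw [Finset.sum_eq_single k₀] at hmain
  · have hvk : (v ^ M)⁻¹ ^ k₀ = v := by
      obtain ⟨t, ht⟩ := hdvd
      have h1 : v * (v ^ M) ^ k₀ = 1 := by
        rw [← pow_mul, ← pow_succ', mul_comm M, add_comm, ht, pow_mul, hv, one_pow]
      rw [inv_pow]
      exact inv_eq_of_mul_eq_one_left h1
    rw [hvk] at hmain
    have hp0 : (p : ℂ) ≠ 0 := by exact_mod_cast hp.ne_zero
    field_simp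
    rw [mul_comm, hmain]
  · intro k hk hkk
    rw [sum_pow_eq_zero_of_coprime (mul_pos hp.pos hM) _ hh h0, mul_zero]
    have h1 : (1 + k * M).Coprime M := by simp
    refine Nat.Coprime.mul_right (Nat.Coprime.symm ((hp.coprime_iff_not_dvd).2 fun hd => hkk ?_)) h1
    rw [hk₀, ← (hiff k).1 hd, ZMod.val_natCast, Nat.mod_eq_of_lt (Finset.mem_range.1 hk)]
  · intro hk
    exact absurd (Finset.mem_range.2 hk₀p) hk

theorem isPrimitiveRoot_nu {n : ℕ} (hn : n ≠ 0) : IsPrimitiveRoot (nu n) n :=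
  Complex.isPrimitiveRoot_exp n hn

theorem IsRootOfUnity.norm_eq_one {z : ℂ} (hz : IsRootOfUnity z) : ‖z‖ = 1 := by
  obtain ⟨n, hn, h⟩ := hz
  exact norm_eq_one_of_pow_eq_one h hn.ne'

theorem IsRootOfUnity.ne_zero {z : ℂ} (hz : IsRootOfUnity z) : z ≠ 0 := by
  rintro rfl
  simpa using hz.norm_eq_one

theorem IsRootOfUnity.mul {z w : ℂ} (hz : IsRootOfUnity z) (hw : IsRootOfUnity w) :
    IsRootOfUnity (z * w) := by
  obtain ⟨m, hm, h⟩ := hz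
  obtain ⟨n, hn, h'⟩ := hw
  refine ⟨m * n, mul_pos hm hn, ?_⟩
  rw [mul_pow, pow_mul, h, one_pow, mul_comm m, pow_mul, h', one_pow, one_mul]

theorem IsRootOfUnity.pow {z : ℂ} (hz : IsRootOfUnity z) (k : ℕ) : IsRootOfUnity (z ^ k) := by
  obtain ⟨m, hm, h⟩ := hz
  exact ⟨m, hm, by rw [← pow_mul, mul_comm, pow_mul, h, one_pow]⟩

theorem IsRootOfUnity.neg {z : ℂ} (hz : IsRootOfUnity z) : IsRootOfUnity (-z) := by
  rw [← neg_one_mul]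
  exact IsRootOfUnity.mul ⟨2, two_pos, by norm_num⟩ hz

theorem isRootOfUnity_nu {n : ℕ} (hn : 0 < n) : IsRootOfUnity (nu n) :=
  ⟨n, hn, (isPrimitiveRoot_nu hn.ne').pow_eq_one⟩

theorem one_add_nu_three : 1 + nu 3 + nu 3 ^ 2 = 0 := by
  simpa [Finset.sum_range_succ] using
    (isPrimitiveRoot_nu (n := 3) (by norm_num)).geom_sum_eq_zero (by norm_num)

theorem one_add_nu_five : 1 + nu 5 + nu 5 ^ 2 + nu 5 ^ 3 + nu 5 ^ 4 = 0 := by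
  simpa [Finset.sum_range_succ] using
    (isPrimitiveRoot_nu (n := 5) (by norm_num)).geom_sum_eq_zero (by norm_num)

theorem eq_neg_nu_three_of_add_eq_one {s t : ℂ} (hs : ‖s‖ = 1) (ht : ‖t‖ = 1) (hst : s + t = 1) :
    s = -nu 3 ∧ t = -(nu 3 ^ 2) ∨ s = -(nu 3 ^ 2) ∧ t = -nu 3 := by
  have hω := one_add_nu_three
  have hs' : s * (starRingEnd ℂ) s = 1 := by rw [Complex.mul_conj']; simp [hs]
  have ht' : t * (starRingEnd ℂ) t = 1 := by rw [Complex.mul_conj']; simp [ht]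
  have hst' : (starRingEnd ℂ) s + (starRingEnd ℂ) t = 1 := by rw [← map_add, hst, map_one]
  have h1 : s * t = 1 := by
    linear_combination t * hs' + s * ht' - s * t * hst' + hst
  have hω3 : nu 3 ^ 3 = 1 := (isPrimitiveRoot_nu (by norm_num)).pow_eq_one
  have h2 : (s + nu 3) * (s + nu 3 ^ 2) = 0 := by
    linear_combination hω3 - h1 + s * hst + s * hω
  rcases mul_eq_zero.1 h2 with h | h
  · exact Or.inl ⟨by linear_combination h, by linear_combination hst - h + hω⟩
  · exact Or.inr ⟨by linear_combination h, by linear_combination hst - h + hω⟩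

theorem IsMinVanishing.map_mul {h : Multiset ℂ} (hh : IsMinVanishing h) {c : ℂ} (hc : c ≠ 0) :
    IsMinVanishing (h.map fun z => c * z) := by
  have hinv : ∀ s : Multiset ℂ, (s.map fun z => c * z).map (fun z => c⁻¹ * z) = s := fun s => by
    simp [Multiset.map_map, hc]
  have hinv' : ∀ s : Multiset ℂ, (s.map fun z => c⁻¹ * z).map (fun z => c * z) = s := fun s => by
    simp [Multiset.map_map, hc]
  refine ⟨by rw [Multiset.sum_map_mul_left, Multiset.map_id', hh.1, mul_zero], ?_⟩
  intro g hg hg0 hgh hsum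
  refine hh.2 (g.map fun z => c⁻¹ * z) ?_ ?_ ?_ ?_
  · simpa only [hinv] using Multiset.map_le_map (f := fun z => c⁻¹ * z) hg
  · simpa using hg0
  · intro h'
    exact hgh (by rw [← h', hinv'])
  · rw [Multiset.sum_map_mul_left, Multiset.map_id', hsum, mul_zero]

theorem IsMinVanishing.eq_of_subset {h g : Multiset ℂ} (hh : IsMinVanishing h) (hg : g.Nodup)
    (hgh : g ⊆ h) (hg0 : g ≠ 0) (hsum : g.sum = 0) : g = h := by
  by_contra hne
  exact hh.2 g ((Multiset.le_iff_subset hg).2 hgh) hg0 hne hsum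

theorem IsMinVanishing.pow_eq_pow {h : Multiset ℂ} (hh : IsMinVanishing h) {M : ℕ} {z₀ : ℂ}
    (hz₀ : z₀ ∈ h) (hsum : (h.filter fun z => z ^ M = z₀ ^ M).sum = 0) :
    ∀ z ∈ h, z ^ M = z₀ ^ M := by
  rw [← Multiset.filter_eq_self]
  by_contra hne
  refine hh.2 _ (Multiset.filter_le _ h) (fun h0 => ?_) hne hsum
  have : z₀ ∈ h.filter fun z => z ^ M = z₀ ^ M := Multiset.mem_filter.2 ⟨hz₀, rfl⟩
  simp [h0] at this

theorem int_eq_zero_of_sq_add_mul_add_sq {a b : ℤ} (h : a ^ 2 + a * b + b ^ 2 = 0) :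
    a = 0 ∧ b = 0 := by
  constructor
  · nlinarith [sq_nonneg (a + 2 * b), sq_nonneg a]
  · nlinarith [sq_nonneg (2 * a + b), sq_nonneg b]

/-- A minimal vanishing multiset of sixth roots of unity has weight at most three. -/
theorem IsMinVanishing.card_le_three {h : Multiset ℂ} (hh : IsMinVanishing h)
    (h6 : ∀ z ∈ h, z ^ 6 = 1) : Multiset.card h ≤ 3 := by
  have hζ : IsPrimitiveRoot (nu 6) 6 := isPrimitiveRoot_nu (by norm_num)
  set ζ := nu 6
  have hζ3 : ζ ^ 3 = -1 := by
    have h1 : (ζ ^ 3 - 1) * (ζ ^ 3 + 1) = 0 := by linear_combination hζ.pow_eq_one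
    rcases mul_eq_zero.1 h1 with h | h
    · exact absurd (sub_eq_zero.1 h) (hζ.pow_ne_one_of_pos_of_lt (by norm_num) (by norm_num))
    · exact eq_neg_of_add_eq_zero_left h
  have hζ2 : ζ ^ 2 = ζ - 1 := by
    have h1 : (ζ + 1) * (ζ ^ 2 - ζ + 1) = 0 := by linear_combination hζ3
    rcases mul_eq_zero.1 h1 with h | h
    · refine absurd ?_ (hζ.pow_ne_one_of_pos_of_lt (l := 2) (by norm_num) (by norm_num))
      linear_combination (ζ - 1) * h
    · linear_combination h
  have hinj : ∀ i j : ℕ, i < 6 → j < 6 → i ≠ j → ζ ^ i ≠ ζ ^ j := fun i j hi hj hij he =>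
    hij (hζ.pow_inj hi hj he)
  have hsum : h.sum = ∑ i ∈ Finset.range 6, (h.count (ζ ^ i) : ℂ) * ζ ^ i := by
    rw [Finset.sum_multiset_count_of_subset h ((Finset.range 6).image fun i => ζ ^ i),
      Finset.sum_image]
    · simp
    · intro i hi j hj he
      exact hζ.pow_inj (by simpa using hi) (by simpa using hj) he
    · intro z hz
      obtain ⟨i, hi, rfl⟩ := hζ.eq_pow_of_pow_eq_one (h6 z (by simpa using hz))
      exact Finset.mem_image_of_mem _ (Finset.mem_range.2 hi)
  rw [hh.1] at hsum
  by_contra! hcard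
  have hopp : ∀ i < 3, h.count (ζ ^ i) = 0 ∨ h.count (ζ ^ (i + 3)) = 0 := fun i hi => by
    by_contra! hc
    have := hh.eq_of_subset (g := {ζ ^ i, ζ ^ (i + 3)})
      (by simpa using hinj i (i + 3) (by omega) (by omega) (by omega))
      (by
        intro z hz
        simp only [Multiset.insert_eq_cons, Multiset.mem_cons, Multiset.mem_singleton] at hz
        rcases hz with rfl | rfl
        · exact Multiset.count_ne_zero.1 hc.1
        · exact Multiset.count_ne_zero.1 hc.2)
      (by simp) (by simp [pow_add, hζ3])
    simp [← this] at hcard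
  have htri : ∀ i < 2, h.count (ζ ^ i) = 0 ∨ h.count (ζ ^ (i + 2)) = 0 ∨
      h.count (ζ ^ (i + 4)) = 0 := fun i hi => by
    by_contra! hc
    have := hh.eq_of_subset (g := {ζ ^ i, ζ ^ (i + 2), ζ ^ (i + 4)})
      (by
        simpa using ⟨⟨hinj i (i + 2) (by omega) (by omega) (by omega),
          hinj i (i + 4) (by omega) (by omega) (by omega)⟩,
          hinj (i + 2) (i + 4) (by omega) (by omega) (by omega)⟩)
      (by
        intro z hz
        simp only [Multiset.insert_eq_cons, Multiset.mem_cons, Multiset.mem_singleton] at hz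
        rcases hz with rfl | rfl | rfl
        · exact Multiset.count_ne_zero.1 hc.1
        · exact Multiset.count_ne_zero.1 hc.2.1
        · exact Multiset.count_ne_zero.1 hc.2.2)
      (by simp)
      (by
        simp only [Multiset.insert_eq_cons, Multiset.sum_cons, Multiset.sum_singleton, pow_add]
        linear_combination ζ ^ i * (ζ ^ 2 + ζ + 1) * hζ2)
    simp [← this] at hcard
  have hne : ∃ i < 6, h.count (ζ ^ i) ≠ 0 := by
    obtain ⟨z, hz⟩ := Multiset.card_pos_iff_exists_mem.1 (by omega : 0 < Multiset.card h)
    obtain ⟨i, hi, rfl⟩ := hζ.eq_pow_of_pow_eq_one (h6 z hz)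
    exact ⟨i, hi, Multiset.count_ne_zero.2 hz⟩
  have hint := int_eq_zero_of_sq_add_mul_add_sq
    (a := h.count (ζ ^ 0) - h.count (ζ ^ 3) - (h.count (ζ ^ 2) - h.count (ζ ^ 5)))
    (b := h.count (ζ ^ 1) - h.count (ζ ^ 4) + (h.count (ζ ^ 2) - h.count (ζ ^ 5))) (by
      rw [← Int.cast_inj (α := ℂ)]
      simp only [Finset.sum_range_succ, Finset.sum_range_zero] at hsum
      push_cast
      generalize (h.count (ζ ^ 0) : ℂ) = n0 at *
      generalize (h.count (ζ ^ 1) : ℂ) = n1 at *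
      generalize (h.count (ζ ^ 2) : ℂ) = n2 at *
      generalize (h.count (ζ ^ 3) : ℂ) = n3 at *
      generalize (h.count (ζ ^ 4) : ℂ) = n4 at *
      generalize (h.count (ζ ^ 5) : ℂ) = n5 at *
      have e : n0 - n3 - (n2 - n5) + (n1 - n4 + (n2 - n5)) * ζ = 0 := by
        linear_combination -hsum - (n3 + n4 * ζ + n5 * ζ ^ 2) * hζ3 - (n2 - n5) * hζ2
      have e' : n0 - n3 - (n2 - n5) = - ((n1 - n4 + (n2 - n5)) * ζ) := by
        linear_combination e
      rw [e']
      linear_combination (n1 - n4 + (n2 - n5)) ^ 2 * hζ2)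
  have h0 := hopp 0 (by norm_num)
  have h1 := hopp 1 (by norm_num)
  have h2 := hopp 2 (by norm_num)
  have h3 := htri 0 (by norm_num)
  have h4 := htri 1 (by norm_num)
  obtain ⟨i, hi, hne⟩ := hne
  interval_cases i <;> simp only [zero_add, Nat.reduceAdd] at * <;> omega

theorem add_eq_map_stmt13Sorou {F : ℂ → Multiset ℂ} (hF : ∀ u, ∀ z ∈ F u, IsRootOfUnity z) {B : ℂ}
    (hB : ∀ u, u ^ 5 = 1 → (F u).sum = u * B) {v : ℂ} (hv : v ^ 5 = 1)
    (hv2 : Multiset.card (F v) = 2)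
    (h1 : ∀ k : ℕ, 0 < k → k < 5 → Multiset.card (F (v * nu 5 ^ k)) = 1) :
    IsRootOfUnity (v * B) ∧
      F v + F (v * nu 5 ^ 1) + F (v * nu 5 ^ 2) + F (v * nu 5 ^ 3) + F (v * nu 5 ^ 4) =
        stmt13Sorou.map fun w => v * B * w := by
  have hν : nu 5 ^ 5 = 1 := (isPrimitiveRoot_nu (by norm_num)).pow_eq_one
  have hsingle : ∀ k : ℕ, 0 < k → k < 5 → F (v * nu 5 ^ k) = {v * B * nu 5 ^ k} := by
    intro k hk hk5
    obtain ⟨z, hz⟩ := Multiset.card_eq_one.1 (h1 k hk hk5)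
    have := hB (v * nu 5 ^ k) (by rw [mul_pow, hv, one_mul, ← pow_mul, mul_comm, pow_mul, hν,
      one_pow])
    rw [hz, Multiset.sum_singleton] at this
    rw [hz, this]
    congr 1
    ring
  have hc : IsRootOfUnity (v * B) := by
    have h2 : IsRootOfUnity (v * B * nu 5 ^ 1) := hF (v * nu 5 ^ 1) _ (by
      rw [hsingle 1 (by norm_num) (by norm_num)]
      exact Multiset.mem_singleton_self _)
    have h3 := h2.mul ((isRootOfUnity_nu (n := 5) (by norm_num)).pow 4)
    rwa [mul_assoc, ← pow_add, hν, mul_one] at h3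
  refine ⟨hc, ?_⟩
  obtain ⟨a, b, hab⟩ := Multiset.card_eq_two.1 hv2
  have hsum := hB v hv
  have ha : ‖a / (v * B)‖ = 1 := by
    rw [norm_div, hc.norm_eq_one, (hF v a (by simp [hab])).norm_eq_one, div_one]
  have hb : ‖b / (v * B)‖ = 1 := by
    rw [norm_div, hc.norm_eq_one, (hF v b (by simp [hab])).norm_eq_one, div_one]
  rw [hab] at hsum
  have hadd : a / (v * B) + b / (v * B) = 1 := by
    rw [← add_div, div_eq_one_iff_eq hc.ne_zero]
    simpa using hsum
  have hpair : F v = {v * B * -nu 3, v * B * -(nu 3 ^ 2)} := by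
    rw [hab]
    rcases eq_neg_nu_three_of_add_eq_one ha hb hadd with ⟨h2, h3⟩ | ⟨h2, h3⟩ <;>
      rw [div_eq_iff hc.ne_zero, mul_comm] at h2 h3 <;> rw [h2, h3]
    exact Multiset.pair_comm _ _
  rw [hpair, hsingle 1 (by norm_num) (by norm_num), hsingle 2 (by norm_num) (by norm_num),
    hsingle 3 (by norm_num) (by norm_num), hsingle 4 (by norm_num) (by norm_num)]
  simp only [stmt13Sorou, Multiset.insert_eq_cons, Multiset.map_cons, Multiset.map_singleton,
    pow_one]
  simp only [← Multiset.singleton_add]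
  abel

theorem eq_sum_filter_pow {p M : ℕ} {ν : ℂ} (hp : p ≠ 0) (hν : IsPrimitiveRoot ν p)
    (hpM : M.Coprime p) {h : Multiset ℂ} (hh : ∀ z ∈ h, z ^ (p * M) = 1) :
    h = ∑ k ∈ Finset.range p, h.filter fun z => z ^ M = (ν ^ k) ^ M := by
  have : NeZero p := ⟨hp⟩
  have hνM := hν.pow_of_coprime M hpM
  ext a
  rw [Multiset.count_sum']
  simp only [Multiset.count_filter]
  by_cases ha : a ∈ h
  · obtain ⟨k, hk, hak⟩ := hνM.eq_pow_of_pow_eq_one (ξ := a ^ M)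
      (by rw [← pow_mul, mul_comm, hh a ha])
    rw [Finset.sum_eq_single k]
    · rw [if_pos (by rw [← hak, ← pow_mul, ← pow_mul, mul_comm])]
    · intro j hj hjk
      rw [if_neg]
      intro h'
      refine hjk (hνM.pow_inj (Finset.mem_range.1 hj) hk ?_)
      rw [hak, h', ← pow_mul, ← pow_mul, mul_comm]
    · intro h'
      exact absurd (Finset.mem_range.2 hk) h'
  · simp [Multiset.count_eq_zero_of_notMem ha]

theorem exists_pow_eq_of_coprime {p M : ℕ} (hp : p.Prime) (hpM : M.Coprime p) {w : ℂ}
    (hw : w ^ p = 1) : ∃ v : ℂ, v ^ p = 1 ∧ v ^ M = w := by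
  obtain ⟨t, ht⟩ := Nat.exists_mul_mod_eq_one_of_coprime hpM hp.one_lt
  refine ⟨w ^ t, by rw [← pow_mul, mul_comm, pow_mul, hw, one_pow], ?_⟩
  rw [← pow_mul, mul_comm, ← Nat.div_add_mod (M * t) p, ht.2, pow_add, pow_mul, hw]
  simp

theorem dvd_six_or_exists_prime {N : ℕ} (hN : N ≠ 0) :
    N ∣ 6 ∨ ∃ p M, p.Prime ∧ N = p * M ∧ (p ∣ M ∨ 5 ≤ p) := by
  by_contra! hc
  obtain ⟨h6, hc⟩ := hc
  have hsq : Squarefree N := by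
    rw [Nat.squarefree_iff_prime_squarefree]
    rintro p hp ⟨c, rfl⟩
    exact (hc p (p * c) hp (mul_assoc _ _ _)).1 (dvd_mul_right _ _)
  have hsub : N.primeFactors ⊆ {2, 3} := by
    intro p hp
    obtain ⟨hp, ⟨M, hM⟩, -⟩ := Nat.mem_primeFactors.1 hp
    have h5 := (hc p M hp hM).2
    interval_cases p <;> simp_all +decide
  apply h6
  rw [← Nat.prod_primeFactors_of_squarefree hsq]
  exact Finset.prod_dvd_prod_of_subset _ _ _ hsub

theorem IsMinVanishing.exists_eq_map_of_pow_eq_one {N : ℕ} (hN : N ≠ 0) {h : Multiset ℂ}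
    (hh : IsMinVanishing h) (hcard : Multiset.card h = 6) (hroot : ∀ z ∈ h, z ^ N = 1) :
    ∃ z : ℂ, IsRootOfUnity z ∧ h = stmt13Sorou.map fun w => z * w := by
  induction N using Nat.strong_induction_on generalizing h with
  | _ N ih =>
  rcases dvd_six_or_exists_prime hN with ⟨c, hc⟩ | ⟨p, M, hp, rfl, hpM⟩
  · have := hh.card_le_three fun z hz => by rw [hc, pow_mul, hroot z hz, one_pow]
    omega
  have hM : M ≠ 0 := by rintro rfl; simp at hN
  have hroots : ∀ z ∈ h, IsRootOfUnity z := fun z hz => ⟨_, Nat.pos_of_ne_zero hN, hroot z hz⟩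
  have descent : ∀ z₀ ∈ h, (h.filter fun z => z ^ M = z₀ ^ M).sum = 0 →
      ∃ z : ℂ, IsRootOfUnity z ∧ h = stmt13Sorou.map fun w => z * w := by
    intro z₀ hz₀ hsum
    have h0 := (hroots z₀ hz₀).ne_zero
    have hM' := hh.pow_eq_pow hz₀ hsum
    obtain ⟨c, hc, hhc⟩ := ih M (lt_mul_of_one_lt_left (Nat.pos_of_ne_zero hM) hp.one_lt) hM
      (hh.map_mul (inv_ne_zero h0)) (by simpa using hcard) (by
        simp only [Multiset.mem_map]
        rintro _ ⟨z, hz, rfl⟩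
        rw [mul_pow, hM' z hz, ← mul_pow, inv_mul_cancel₀ h0, one_pow])
    refine ⟨z₀ * c, (hroots z₀ hz₀).mul hc, ?_⟩
    have := congrArg (Multiset.map fun z => z₀ * z) hhc
    simpa [Multiset.map_map, h0, mul_assoc] using this
  obtain ⟨z₀, hz₀⟩ := Multiset.card_pos_iff_exists_mem.1 (by omega : 0 < Multiset.card h)
  have hz₀p : (z₀ ^ M) ^ p = 1 := by rw [← pow_mul, mul_comm, hroot z₀ hz₀]
  by_cases hdvd : p ∣ M
  · exact descent z₀ hz₀
      (sum_filter_pow_eq_zero hp (Nat.pos_of_ne_zero hM) hdvd hroot hh.1 hz₀p)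
  obtain ⟨B, hB⟩ := exists_sum_filter_pow_eq hp (Nat.pos_of_ne_zero hM) hdvd hroot hh.1
  have hcop : M.Coprime p := ((hp.coprime_iff_not_dvd).2 hdvd).symm
  by_cases hB0 : B = 0
  · obtain ⟨v, hv, hvM⟩ := exists_pow_eq_of_coprime hp hcop hz₀p
    refine descent z₀ hz₀ ?_
    rw [← hvM, hB v hv, hB0, mul_zero]
  have hν : IsPrimitiveRoot (nu p) p := isPrimitiveRoot_nu hp.ne_zero
  have hdecomp := eq_sum_filter_pow hp.ne_zero hν hcop hroot
  set F : ℂ → Multiset ℂ := fun v => h.filter fun z => z ^ M = v ^ M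
  have hpos : ∀ v : ℂ, v ^ p = 1 → 1 ≤ Multiset.card (F v) := fun v hv => by
    rw [Nat.one_le_iff_ne_zero, Ne, Multiset.card_eq_zero]
    intro h0
    have h1 := hB v hv
    have hv0 : v ≠ 0 := by rintro rfl; simp [hp.ne_zero] at hv
    change (F v).sum = _ at h1
    rw [h0, Multiset.sum_zero, eq_comm, mul_eq_zero] at h1
    tauto
  have hνk : ∀ k : ℕ, (nu p ^ k) ^ p = 1 := fun k => by
    rw [← pow_mul, mul_comm, pow_mul, hν.pow_eq_one, one_pow]
  have hcards : ∑ k ∈ Finset.range p, Multiset.card (F (nu p ^ k)) = 6 := by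
    rw [← hcard, ← Multiset.card_sum, ← hdecomp]
  have hp6 : p ≤ 6 := by
    rw [← hcards]
    simpa using Finset.sum_le_sum fun k (_ : k ∈ Finset.range p) => hpos _ (hνk k)
  obtain rfl : p = 5 := by
    have h5 : 5 ≤ p := hpM.resolve_left hdvd
    interval_cases p
    · rfl
    · exact absurd hp (by norm_num)
  have hper : ∀ k, nu 5 ^ (k + 5) = nu 5 ^ k := fun k => by
    rw [pow_add, hν.pow_eq_one, mul_one]
  have hFroot : ∀ u, ∀ z ∈ F u, IsRootOfUnity z := fun u z hz =>
    hroots z (Multiset.mem_of_mem_filter hz)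
  change h = ∑ k ∈ Finset.range 5, F (nu 5 ^ k) at hdecomp
  have h0 := hpos _ (hνk 0)
  have h1 := hpos _ (hνk 1)
  have h2 := hpos _ (hνk 2)
  have h3 := hpos _ (hνk 3)
  have h4 := hpos _ (hνk 4)
  simp only [Finset.sum_range_succ, Finset.sum_range_zero, zero_add] at hcards hdecomp
  have p5 := hper 0
  have p6 := hper 1
  have p7 := hper 2
  have p8 := hper 3
  simp only [zero_add, Nat.reduceAdd] at p5 p6 p7 p8
  have hj : ∃ j < 5, Multiset.card (F (nu 5 ^ j)) = 2 := by
    by_contra! hc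
    have c0 := hc 0 (by norm_num)
    have c1 := hc 1 (by norm_num)
    have c2 := hc 2 (by norm_num)
    have c3 := hc 3 (by norm_num)
    have c4 := hc 4 (by norm_num)
    omega
  obtain ⟨j, hj5, hj2⟩ := hj
  have hrest : ∀ k : ℕ, 0 < k → k < 5 → Multiset.card (F (nu 5 ^ j * nu 5 ^ k)) = 1 := by
    intro k hk hk5
    rw [← pow_add]
    interval_cases j <;> interval_cases k <;> simp only [Nat.reduceAdd, p5, p6, p7, p8] <;> omega
  obtain ⟨hc, hmap⟩ := add_eq_map_stmt13Sorou hFroot hB (hνk j) hj2 hrest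
  refine ⟨_, hc, ?_⟩
  rw [← hmap, hdecomp]
  simp only [← pow_add]
  interval_cases j <;> simp only [Nat.reduceAdd, p5, p6, p7, p8] <;> abel

theorem isSorou_stmt13Sorou : IsSorou stmt13Sorou := by
  have h3 : IsRootOfUnity (nu 3) := isRootOfUnity_nu (by norm_num)
  have h5 : IsRootOfUnity (nu 5) := isRootOfUnity_nu (by norm_num)
  refine ⟨by simp [stmt13Sorou], ?_⟩
  simp only [stmt13Sorou, Multiset.insert_eq_cons, Multiset.mem_cons, Multiset.mem_singleton]
  rintro z (rfl | rfl | rfl | rfl | rfl | rfl)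
  exacts [h5, h5.pow 2, h5.pow 3, h5.pow 4, h3.neg, (h3.pow 2).neg]

theorem nodup_stmt13Sorou : stmt13Sorou.Nodup := by
  have hν : IsPrimitiveRoot (nu 5) 5 := isPrimitiveRoot_nu (by norm_num)
  have hω : IsPrimitiveRoot (nu 3) 3 := isPrimitiveRoot_nu (by norm_num)
  have hinj : ∀ i j : ℕ, i < 5 → j < 5 → i ≠ j → nu 5 ^ i ≠ nu 5 ^ j := fun i j hi hj hij he =>
    hij (hν.pow_inj hi hj he)
  have hne : ∀ (i : ℕ) (z : ℂ), z ^ 6 = 1 → 0 < i → i < 5 → nu 5 ^ i ≠ z := by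
    rintro i z hz hi hi5 rfl
    refine hν.pow_ne_one_of_pos_of_lt hi.ne' hi5 ?_
    calc nu 5 ^ i = (nu 5 ^ i) ^ 6 := by
          rw [pow_succ, pow_right_comm, hν.pow_eq_one, one_pow, one_mul]
      _ = 1 := hz
  have hω1 : (-nu 3) ^ 6 = 1 := by linear_combination (nu 3 ^ 3 + 1) * hω.pow_eq_one
  have hω2 : (-(nu 3 ^ 2)) ^ 6 = 1 := by
    linear_combination (nu 3 ^ 9 + nu 3 ^ 6 + nu 3 ^ 3 + 1) * hω.pow_eq_one
  have hω12 : nu 3 ≠ nu 3 ^ 2 := fun he => by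
    have := hω.pow_inj (i := 1) (j := 2) (by norm_num) (by norm_num) (by simpa using he)
    omega
  have hinj1 := hinj 1
  have hne1 := hne 1
  simp only [pow_one] at hinj1 hne1
  simp only [stmt13Sorou, Multiset.insert_eq_cons, Multiset.nodup_cons, Multiset.mem_cons,
    Multiset.mem_singleton, Multiset.nodup_singleton, not_or, and_true, neg_inj]
  refine ⟨⟨?_, ?_, ?_, ?_, ?_⟩, ⟨?_, ?_, ?_, ?_⟩, ⟨?_, ?_, ?_⟩, ⟨?_, ?_⟩, hω12⟩
  all_goals first
    | exact hinj1 _ (by norm_num) (by norm_num) (by norm_num)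
    | exact hne1 _ ‹_› (by norm_num) (by norm_num)
    | exact hinj _ _ (by norm_num) (by norm_num) (by norm_num)
    | exact hne _ _ ‹_› (by norm_num) (by norm_num)

theorem sum_filter_eq_sum_map_ite {α : Type*} [AddCommMonoid α] (P : α → Prop) [DecidablePred P]
    (s : Multiset α) : (s.filter P).sum = (s.map fun a => if P a then a else 0).sum := by
  induction s using Multiset.induction_on with
  | empty => simp
  | cons a s ih => by_cases h : P a <;> simp [h, ih]

theorem isMinVanishing_stmt13Sorou : IsMinVanishing stmt13Sorou := by
  have hν : IsPrimitiveRoot (nu 5) 5 := isPrimitiveRoot_nu (by norm_num)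
  have hω : IsPrimitiveRoot (nu 3) 3 := isPrimitiveRoot_nu (by norm_num)
  have hν0 : nu 5 ≠ 0 := (isRootOfUnity_nu (by norm_num)).ne_zero
  have hω0 : nu 3 ≠ 0 := (isRootOfUnity_nu (by norm_num)).ne_zero
  have hνs := one_add_nu_five
  have hωs := one_add_nu_three
  have hω1 : (-nu 3) ^ 6 = 1 := by linear_combination (nu 3 ^ 3 + 1) * hω.pow_eq_one
  have hω2 : (-(nu 3 ^ 2)) ^ 6 = 1 := by
    linear_combination (nu 3 ^ 9 + nu 3 ^ 6 + nu 3 ^ 3 + 1) * hω.pow_eq_one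
  have h6 : ∀ v : ℂ, v ^ 5 = 1 → v ^ 6 = v := fun v hv => by rw [pow_succ, hv, one_mul]
  have h5k : ∀ k, (nu 5 ^ k) ^ 5 = 1 := fun k => by
    rw [← pow_mul, mul_comm, pow_mul, hν.pow_eq_one, one_pow]
  refine ⟨?_, fun g hg hg0 hgh hsum => ?_⟩
  · simp only [stmt13Sorou, Multiset.insert_eq_cons, Multiset.sum_cons, Multiset.sum_singleton]
    linear_combination hνs - hωs
  have hgf : stmt13Sorou.filter (· ∈ g) = g := by
    refine le_antisymm ((Multiset.le_iff_subset (nodup_stmt13Sorou.filter _)).2 fun z hz =>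
      (Multiset.mem_filter.1 hz).2) ?_
    exact (Multiset.le_iff_subset (Multiset.nodup_of_le hg nodup_stmt13Sorou)).2 fun z hz =>
      Multiset.mem_filter.2 ⟨Multiset.mem_of_le hg hz, hz⟩
  have hroot : ∀ z ∈ g, z ^ (5 * 6) = 1 := fun z hz => by
    have := Multiset.mem_of_le hg hz
    simp only [stmt13Sorou, Multiset.insert_eq_cons, Multiset.mem_cons,
      Multiset.mem_singleton] at this
    have h1 := h5k 1
    rw [pow_one] at h1
    rcases this with rfl | rfl | rfl | rfl | rfl | rfl
    · rw [pow_mul, h1, one_pow]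
    · rw [pow_mul, h5k, one_pow]
    · rw [pow_mul, h5k, one_pow]
    · rw [pow_mul, h5k, one_pow]
    · rw [mul_comm, pow_mul, hω1, one_pow]
    · rw [mul_comm, pow_mul, hω2, one_pow]
  obtain ⟨B, hB⟩ := exists_sum_filter_pow_eq Nat.prime_five (by norm_num) (by norm_num) hroot hsum
  have hinj : ∀ i j : ℕ, i < 5 → j < 5 → (nu 5 ^ i = nu 5 ^ j ↔ i = j) := fun i j hi hj =>
    ⟨fun he => hν.pow_inj hi hj he, fun h => h ▸ rfl⟩
  have hsum' : ∀ k < 5,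
      (if k = 1 ∧ nu 5 ∈ g then nu 5 else 0) + ((if k = 2 ∧ nu 5 ^ 2 ∈ g then nu 5 ^ 2 else 0) +
      ((if k = 3 ∧ nu 5 ^ 3 ∈ g then nu 5 ^ 3 else 0) +
      ((if k = 4 ∧ nu 5 ^ 4 ∈ g then nu 5 ^ 4 else 0) +
      ((if k = 0 ∧ -nu 3 ∈ g then -nu 3 else 0) +
      (if k = 0 ∧ -(nu 3 ^ 2) ∈ g then -(nu 3 ^ 2) else 0))))) = nu 5 ^ k * B := by
    intro k hk
    have h1 := hB (nu 5 ^ k) (h5k k)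
    rw [← hgf, Multiset.filter_filter, sum_filter_eq_sum_map_ite, h6 _ (h5k k)] at h1
    have i1 := hinj 1 k (by norm_num) hk
    have i0 := hinj 0 k (by norm_num) hk
    rw [pow_one] at i1
    rw [pow_zero] at i0
    have n6 := h6 _ (h5k 1)
    rw [pow_one] at n6
    simpa only [stmt13Sorou, Multiset.insert_eq_cons, Multiset.map_cons, Multiset.map_singleton,
      Multiset.sum_cons, Multiset.sum_singleton, n6, h6 _ (h5k _), hω1, hω2, i0, i1,
      hinj 2 k (by norm_num) hk, hinj 3 k (by norm_num) hk, hinj 4 k (by norm_num) hk,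
      eq_comm (b := k)] using h1
  have e0 := hsum' 0 (by norm_num)
  have e1 := hsum' 1 (by norm_num)
  have e2 := hsum' 2 (by norm_num)
  have e3 := hsum' 3 (by norm_num)
  have e4 := hsum' 4 (by norm_num)
  norm_num at e0 e1 e2 e3 e4
  by_cases hB0 : B = 0
  · subst hB0
    simp only [mul_zero, ite_eq_right_iff, pow_eq_zero_iff', hν0, false_and, imp_false]
      at e1 e2 e3 e4
    obtain ⟨z, hz⟩ := Multiset.exists_mem_of_ne_zero hg0
    have hzh := Multiset.mem_of_le hg hz
    simp only [stmt13Sorou, Multiset.insert_eq_cons, Multiset.mem_cons,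
      Multiset.mem_singleton] at hzh
    have : -nu 3 ∉ g ∧ -(nu 3 ^ 2) ∉ g := by
      by_cases ha : -nu 3 ∈ g <;> by_cases hb : -(nu 3 ^ 2) ∈ g <;> simp [ha, hb, hω0] at e0 ⊢
      exact one_ne_zero (α := ℂ) (by linear_combination hωs + e0)
    rcases hzh with rfl | rfl | rfl | rfl | rfl | rfl <;> tauto
  · have m1 : nu 5 ∈ g := by by_contra hc; simp [hc, hν0, hB0] at e1
    have m2 : nu 5 ^ 2 ∈ g := by by_contra hc; simp [hc, hν0, hB0] at e2
    have m3 : nu 5 ^ 3 ∈ g := by by_contra hc; simp [hc, hν0, hB0] at e3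
    have m4 : nu 5 ^ 4 ∈ g := by by_contra hc; simp [hc, hν0, hB0] at e4
    have hB1 : B = 1 := by simpa [m1, hν0] using e1.symm
    have : -nu 3 ∈ g ∧ -(nu 3 ^ 2) ∈ g := by
      rw [hB1] at e0
      by_cases ha : -nu 3 ∈ g <;> by_cases hb : -(nu 3 ^ 2) ∈ g <;> simp [ha, hb] at e0 ⊢
      · exact hω0 (pow_eq_zero_iff (n := 2) (by norm_num) |>.1 (by linear_combination hωs + e0))
      · exact hω0 (by linear_combination hωs + e0)
    refine hgh (le_antisymm hg ((Multiset.le_iff_subset nodup_stmt13Sorou).2 fun z hz => ?_))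
    simp only [stmt13Sorou, Multiset.insert_eq_cons, Multiset.mem_cons,
      Multiset.mem_singleton] at hz
    rcases hz with rfl | rfl | rfl | rfl | rfl | rfl <;> tauto

theorem IsSorou.exists_pow_eq_one {h : Multiset ℂ} (hh : IsSorou h) :
    ∃ N : ℕ, N ≠ 0 ∧ ∀ z ∈ h, z ^ N = 1 := by
  have key : ∀ s : Multiset ℂ, (∀ z ∈ s, IsRootOfUnity z) → ∃ N : ℕ, N ≠ 0 ∧ ∀ z ∈ s, z ^ N = 1 := by
    intro s
    induction s using Multiset.induction_on with
    | empty => exact fun _ => ⟨1, by simp⟩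
    | cons a s ih =>
      intro hs
      obtain ⟨N, hN, hsN⟩ := ih fun z hz => hs z (Multiset.mem_cons_of_mem hz)
      obtain ⟨n, hn, ha⟩ := hs a (Multiset.mem_cons_self a s)
      refine ⟨n * N, mul_ne_zero hn.ne' hN, fun z hz => ?_⟩
      rcases Multiset.mem_cons.1 hz with rfl | hz
      · rw [pow_mul, ha, one_pow]
      · rw [mul_comm, pow_mul, hsN z hz, one_pow]
  exact key h hh.2

theorem stmt_13 :
    (∀ h : Multiset ℂ, IsSorou h → IsMinVanishing h → Multiset.card h = 6 →
      ∃ z : ℂ, IsRootOfUnity z ∧ h = stmt13Sorou.map fun w => z * w) ∧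
    (IsSorou stmt13Sorou ∧ IsMinVanishing stmt13Sorou) := by
  refine ⟨fun h hs hv hcard => ?_, isSorou_stmt13Sorou, isMinVanishing_stmt13Sorou⟩
  obtain ⟨N, hN, hroot⟩ := hs.exists_pow_eq_one
  exact hv.exists_eq_map_of_pow_eq_one hN hcard hroot
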